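/- arXiv:1205.0736 — 2 statements merged into one kernel-verified Lean document; each statement's English description precedes it below -/
import Mathlib

section
/- Let ε > 0 and a ≥ 0 be real numbers. Suppose f : ℝ → ℂ satisfies HasDerivAt f 0 x for every x ∈ (0, ε) (i.e. f is differentiable on (0, ε) with identically zero derivative there), and suppose ∫₀^ε |f(x)|² x^{-2a-1} dx < ∞ (i.e. x ↦ |f(x)|² x^{-2a-1} is integrable on (0, ε)). Then f(x) = 0 for all x ∈ (0, ε). -/
open MeasureTheory

/-- If `f : ℝ → ℂ` has zero derivative at every point of `(0, ε)` and
`∫₀^ε |f x|² x^(-2a-1) dx < ∞` with `a ≥ 0`, then `f = 0` on `(0, ε)`. -/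
theorem weighted_zero_form_vanishes (ε a : ℝ) (hε : 0 < ε) (ha : 0 ≤ a) (f : ℝ → ℂ)
    (hf : ∀ x ∈ Set.Ioo (0 : ℝ) ε, HasDerivAt f 0 x)
    (hint : IntegrableOn (fun x : ℝ => ‖f x‖ ^ 2 * x ^ (-2 * a - 1)) (Set.Ioo 0 ε)) :
    ∀ x ∈ Set.Ioo (0 : ℝ) ε, f x = 0 := by
  intro x hx
  by_contra hfx
  have hconst : ∀ y ∈ Set.Ioo (0 : ℝ) ε, f y = f x := fun y hy =>
    isOpen_Ioo.is_const_of_deriv_eq_zero isPreconnected_Ioo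
      (fun z hz => (hf z hz).differentiableAt.differentiableWithinAt)
      (fun z hz => (hf z hz).deriv) hy hx
  have hconstint :
      IntegrableOn (fun y : ℝ => ‖f x‖ ^ 2 * y ^ (-2 * a - 1)) (Set.Ioo 0 ε) :=
    hint.congr_fun (fun y hy => by simp only [hconst y hy]) measurableSet_Ioo
  have hne : ‖f x‖ ^ 2 ≠ 0 := pow_ne_zero 2 (norm_ne_zero_iff.mpr hfx)
  have hpow : IntegrableOn (fun y : ℝ => y ^ (-2 * a - 1)) (Set.Ioo 0 ε) :=
    (integrable_const_mul_iff hne.isUnit _).mp hconstint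
  have := (intervalIntegral.integrableOn_Ioo_rpow_iff hε).mp hpow
  linarith
end

section
/- Let ε > 0 and b > 0 be real numbers, and let g : (0, ε) → ℂ be continuous with A := ∫₀^ε |g(t)|² t^{1-2b} dt < ∞. Define f(x) := ∫₀^x g(t) dt for x ∈ (0, ε) (the integral exists). Then HasDerivAt f (g(x)) x for every x ∈ (0, ε), and ∫₀^ε |f(x)|² x^{-2b-1} dx ≤ A / b². -/
open MeasureTheory

open Set ENNReal in
/-- Weighted Cauchy–Schwarz inequality for the Lebesgue integral in `ℝ≥0∞`. -/
theorem lintegral_sq_le_lintegral_weight_mul {α : Type*} [MeasurableSpace α] {μ : Measure α}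
    {u v w : α → ℝ≥0∞} (hu : AEMeasurable u μ) (hv : AEMeasurable v μ) (hw : AEMeasurable w μ)
    (hvw : ∀ᵐ t ∂μ, v t * w t = 1) :
    (∫⁻ t, u t ∂μ) ^ 2 ≤ (∫⁻ t, u t ^ 2 * v t ∂μ) * ∫⁻ t, w t ∂μ := by
  have hsqrt (c : ℝ≥0∞) : (c ^ (1 / 2 : ℝ)) ^ 2 = c := by
    rw [← ENNReal.rpow_natCast, ← ENNReal.rpow_mul]; norm_num
  have hCS := ENNReal.lintegral_mul_le_Lp_mul_Lq μ Real.HolderConjugate.two_two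
    (hu.mul (hv.pow_const (1 / 2 : ℝ))) (hw.pow_const (1 / 2 : ℝ))
  have hprod : ∫⁻ t, u t ∂μ =
      ∫⁻ t, ((fun t => u t * v t ^ (1 / 2 : ℝ)) * fun t => w t ^ (1 / 2 : ℝ)) t ∂μ := by
    refine lintegral_congr_ae ?_
    filter_upwards [hvw] with t ht
    simp only [Pi.mul_apply]
    rw [mul_assoc, ← ENNReal.mul_rpow_of_nonneg _ _ (by norm_num), ht]
    simp
  rw [hprod]
  refine (pow_le_pow_left' hCS 2).trans_eq ?_
  rw [mul_pow, hsqrt, hsqrt]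
  simp only [Pi.mul_apply, ENNReal.rpow_two, mul_pow, hsqrt]

open Set ENNReal in
/-- Tonelli's theorem on the triangle `0 < t < x < ε`. -/
theorem lintegral_Ioo_mul_lintegral_Ioo_swap {ε : ℝ} {h k : ℝ → ℝ≥0∞}
    (hh : AEMeasurable h (volume.restrict (Ioo 0 ε))) (hk : Measurable k) :
    ∫⁻ x in Ioo 0 ε, k x * ∫⁻ t in Ioo 0 x, h t =
      ∫⁻ t in Ioo 0 ε, h t * ∫⁻ x in Ioo t ε, k x := by
  set μ := volume.restrict (Ioo (0 : ℝ) ε) with hμ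
  have hmeas : AEMeasurable (Function.uncurry fun x t : ℝ =>
      {p : ℝ × ℝ | p.2 < p.1}.indicator (fun p => k p.1 * h p.2) (x, t)) (μ.prod μ) :=
    ((hk.comp measurable_fst).aemeasurable.mul hh.comp_snd).indicator
      (measurableSet_lt measurable_snd measurable_fst)
  have hl : ∀ x ∈ Ioo 0 ε, k x * ∫⁻ t in Ioo 0 x, h t =
      ∫⁻ t, {p : ℝ × ℝ | p.2 < p.1}.indicator (fun p => k p.1 * h p.2) (x, t) ∂μ := by
    intro x hx
    have hset : Ioo 0 x = Iio x ∩ Ioo 0 ε := by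
      ext t; simp only [mem_Ioo, mem_inter_iff, mem_Iio]
      exact ⟨fun ht => ⟨ht.2, ht.1, ht.2.trans hx.2⟩, fun ht => ⟨ht.2.1, ht.1⟩⟩
    rw [hset, ← Measure.restrict_restrict measurableSet_Iio, ← hμ,
      ← lintegral_const_mul'' _ hh.restrict, ← lintegral_indicator measurableSet_Iio]
    rfl
  have hr : ∀ t ∈ Ioo 0 ε, h t * ∫⁻ x in Ioo t ε, k x =
      ∫⁻ x, {p : ℝ × ℝ | p.2 < p.1}.indicator (fun p => k p.1 * h p.2) (x, t) ∂μ := by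
    intro t ht
    have hset : Ioo t ε = Ioi t ∩ Ioo 0 ε := by
      ext x; simp only [mem_Ioo, mem_inter_iff, mem_Ioi]
      exact ⟨fun hx => ⟨hx.1, ht.1.trans hx.1, hx.2⟩, fun hx => ⟨hx.1, hx.2.2⟩⟩
    rw [hset, ← Measure.restrict_restrict measurableSet_Ioi, ← hμ, mul_comm,
      ← lintegral_mul_const _ hk, ← lintegral_indicator measurableSet_Ioi]
    rfl
  rw [setLIntegral_congr_fun measurableSet_Ioo hl, setLIntegral_congr_fun measurableSet_Ioo hr]
  exact lintegral_lintegral_swap hmeas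

open Set in
theorem lintegral_Ioo_zero_rpow_sub_one {b x : ℝ} (hb : 0 < b) (hx : 0 ≤ x) :
    ∫⁻ t in Ioo 0 x, ENNReal.ofReal (t ^ (b - 1)) = ENNReal.ofReal (x ^ b / b) := by
  have hint : IntegrableOn (fun t : ℝ => t ^ (b - 1)) (Ioo 0 x) :=
    ((intervalIntegrable_iff_integrableOn_Ioo_of_le hx).1
      (intervalIntegral.intervalIntegrable_rpow' (by linarith)))
  rw [← ofReal_integral_eq_lintegral_ofReal hint
    (ae_restrict_of_forall_mem measurableSet_Ioo fun t ht => Real.rpow_nonneg ht.1.le _),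
    ← integral_Ioc_eq_integral_Ioo, ← intervalIntegral.integral_of_le hx,
    integral_rpow (Or.inl (by linarith))]
  simp [Real.zero_rpow hb.ne']

open Set in
theorem lintegral_Ioo_rpow_neg_sub_one_le {b t ε : ℝ} (hb : 0 < b) (ht : 0 < t) :
    ∫⁻ x in Ioo t ε, ENNReal.ofReal (x ^ (-b - 1)) ≤ ENNReal.ofReal (t ^ (-b) / b) := by
  refine (lintegral_mono_set Ioo_subset_Ioi_self).trans ?_
  rw [← ofReal_integral_eq_lintegral_ofReal (integrableOn_Ioi_rpow_of_lt (by linarith) ht)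
    (ae_restrict_of_forall_mem measurableSet_Ioi fun x hx =>
      Real.rpow_nonneg (ht.trans hx).le _), integral_Ioi_rpow_of_lt (by linarith) ht]
  simp [neg_div_neg_eq]

open Set in
theorem integrableOn_Ioo_of_weighted_sq {ε b : ℝ} (hε : 0 ≤ ε) (hb : 0 < b) {g : ℝ → ℂ}
    (hg : AEStronglyMeasurable g (volume.restrict (Ioo 0 ε)))
    (hA : IntegrableOn (fun t : ℝ => ‖g t‖ ^ 2 * t ^ (1 - 2 * b)) (Ioo 0 ε)) :
    IntegrableOn g (Ioo 0 ε) := by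
  have hpow : IntegrableOn (fun t : ℝ => t ^ (2 * b - 1)) (Ioo 0 ε) :=
    (intervalIntegrable_iff_integrableOn_Ioo_of_le hε).1
      (intervalIntegral.intervalIntegrable_rpow' (by linarith))
  refine (hA.add hpow).mono' hg (ae_restrict_of_forall_mem measurableSet_Ioo fun t ht => ?_)
  have hu : 0 < t ^ (1 - 2 * b) := Real.rpow_pos_of_pos ht.1 _
  have huv : t ^ (1 - 2 * b) * t ^ (2 * b - 1) = 1 := by
    rw [← Real.rpow_add ht.1]; simp
  simp only [Pi.add_apply]
  refine le_of_mul_le_mul_left ?_ hu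
  nlinarith [sq_nonneg (‖g t‖ * t ^ (1 - 2 * b) - 1), mul_nonneg (norm_nonneg (g t)) hu.le]

open Set in
/-- The weighted Hardy inequality for the lower Lebesgue integral. -/
theorem lintegral_sq_lintegral_mul_rpow_le {ε b : ℝ} (hb : 0 < b) {u : ℝ → ENNReal}
    (hu : AEMeasurable u (volume.restrict (Ioo 0 ε))) :
    ∫⁻ x in Ioo 0 ε, (∫⁻ t in Ioo 0 x, u t) ^ 2 * ENNReal.ofReal (x ^ (-2 * b - 1)) ≤
      ENNReal.ofReal (1 / b ^ 2) *
        ∫⁻ t in Ioo 0 ε, u t ^ 2 * ENNReal.ofReal (t ^ (1 - 2 * b)) := by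
  have hmeas (a : ℝ) : Measurable fun t : ℝ => ENNReal.ofReal (t ^ a) := by fun_prop
  have hCS : ∀ x ∈ Ioo 0 ε,
      (∫⁻ t in Ioo 0 x, u t) ^ 2 * ENNReal.ofReal (x ^ (-2 * b - 1)) ≤
        ENNReal.ofReal (1 / b) * (ENNReal.ofReal (x ^ (-b - 1)) *
          ∫⁻ t in Ioo 0 x, u t ^ 2 * ENNReal.ofReal (t ^ (1 - b))) := by
    intro x hx
    have h := lintegral_sq_le_lintegral_weight_mul
      (hu.mono_measure (Measure.restrict_mono (Ioo_subset_Ioo_right hx.2.le) le_rfl))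
      (hmeas (1 - b)).aemeasurable (hmeas (b - 1)).aemeasurable
      (ae_restrict_of_forall_mem measurableSet_Ioo fun t ht => by
        rw [← ENNReal.ofReal_mul (Real.rpow_nonneg ht.1.le _), ← Real.rpow_add ht.1]; simp)
    rw [lintegral_Ioo_zero_rpow_sub_one hb hx.1.le] at h
    refine (mul_le_mul_left h _).trans_eq ?_
    have hx' : x ^ b / b * x ^ (-2 * b - 1) = 1 / b * x ^ (-b - 1) := by
      rw [div_mul_eq_mul_div, ← Real.rpow_add hx.1]; ring_nf
    rw [mul_assoc, ← ENNReal.ofReal_mul (div_nonneg (Real.rpow_nonneg hx.1.le _) hb.le), hx',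
      ENNReal.ofReal_mul (by positivity)]
    ring
  have htail : ∀ t ∈ Ioo 0 ε,
      u t ^ 2 * ENNReal.ofReal (t ^ (1 - b)) * ∫⁻ x in Ioo t ε, ENNReal.ofReal (x ^ (-b - 1)) ≤
        ENNReal.ofReal (1 / b) * (u t ^ 2 * ENNReal.ofReal (t ^ (1 - 2 * b))) := by
    intro t ht
    refine (mul_le_mul_right (lintegral_Ioo_rpow_neg_sub_one_le hb ht.1) _).trans_eq ?_
    have ht' : t ^ (1 - b) * (t ^ (-b) / b) = 1 / b * t ^ (1 - 2 * b) := by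
      rw [← mul_div_assoc, ← Real.rpow_add ht.1]; ring_nf
    rw [mul_assoc, ← ENNReal.ofReal_mul (Real.rpow_nonneg ht.1.le _), ht',
      ENNReal.ofReal_mul (by positivity)]
    ring
  calc _ ≤ ∫⁻ x in Ioo 0 ε, ENNReal.ofReal (1 / b) * (ENNReal.ofReal (x ^ (-b - 1)) *
          ∫⁻ t in Ioo 0 x, u t ^ 2 * ENNReal.ofReal (t ^ (1 - b))) :=
        setLIntegral_mono' measurableSet_Ioo hCS
    _ = ENNReal.ofReal (1 / b) * ∫⁻ t in Ioo 0 ε, u t ^ 2 * ENNReal.ofReal (t ^ (1 - b)) *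
          ∫⁻ x in Ioo t ε, ENNReal.ofReal (x ^ (-b - 1)) := by
        rw [lintegral_const_mul' _ _ ENNReal.ofReal_ne_top]
        exact congrArg _ (lintegral_Ioo_mul_lintegral_Ioo_swap
          ((hu.pow_const 2).mul (hmeas _).aemeasurable) (hmeas _))
    _ ≤ ENNReal.ofReal (1 / b) * ∫⁻ t in Ioo 0 ε,
          ENNReal.ofReal (1 / b) * (u t ^ 2 * ENNReal.ofReal (t ^ (1 - 2 * b))) := by
        gcongr _ * ?_
        exact setLIntegral_mono' measurableSet_Ioo htail
    _ = _ := by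
        rw [lintegral_const_mul' _ _ ENNReal.ofReal_ne_top, ← mul_assoc,
          ← ENNReal.ofReal_mul (by positivity)]
        congr 2
        field_simp

/-- Weighted Hardy inequality: if `g` is continuous on `(0, ε)` with
`A = ∫₀^ε |g t|² t^(1-2b) dt < ∞` and `b > 0`, then `f x := ∫₀^x g t dt` satisfies
`f' = g` on `(0, ε)` and `∫₀^ε |f x|² x^(-2b-1) dx ≤ A / b²`. -/
theorem weighted_hardy_inequality (ε b : ℝ) (hε : 0 < ε) (hb : 0 < b) (g : ℝ → ℂ)
    (hg : ContinuousOn g (Set.Ioo 0 ε))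
    (hA : IntegrableOn (fun t : ℝ => ‖g t‖ ^ 2 * t ^ (1 - 2 * b)) (Set.Ioo 0 ε)) :
    (∀ x ∈ Set.Ioo (0 : ℝ) ε,
      HasDerivAt (fun y : ℝ => ∫ t in Set.Ioo (0 : ℝ) y, g t) (g x) x) ∧
    (∫⁻ x in Set.Ioo (0 : ℝ) ε,
        ENNReal.ofReal (‖∫ t in Set.Ioo (0 : ℝ) x, g t‖ ^ 2 * x ^ (-2 * b - 1))) ≤
      ENNReal.ofReal ((∫ t in Set.Ioo (0 : ℝ) ε, ‖g t‖ ^ 2 * t ^ (1 - 2 * b)) / b ^ 2) := by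
  have hgm : AEStronglyMeasurable g (volume.restrict (Set.Ioo 0 ε)) :=
    hg.aestronglyMeasurable measurableSet_Ioo
  have hofReal (z : ℂ) (c : ℝ) :
      ENNReal.ofReal (‖z‖ ^ 2 * c) = ‖z‖ₑ ^ 2 * ENNReal.ofReal c := by
    rw [ENNReal.ofReal_mul (by positivity), ENNReal.ofReal_pow (norm_nonneg z), ofReal_norm]
  constructor
  · intro x hx
    have hint : IntervalIntegrable g volume 0 x :=
      (intervalIntegrable_iff_integrableOn_Ioo_of_le hx.1.le).2
        ((integrableOn_Ioo_of_weighted_sq hε.le hb hgm hA).mono_set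
          (Set.Ioo_subset_Ioo_right hx.2.le))
    refine (intervalIntegral.integral_hasDerivAt_right hint
      (hg.stronglyMeasurableAtFilter isOpen_Ioo x hx)
      (hg.continuousAt (isOpen_Ioo.mem_nhds hx))).congr_of_eventuallyEq ?_
    filter_upwards [lt_mem_nhds hx.1] with y hy
    rw [intervalIntegral.integral_of_le hy.le, integral_Ioc_eq_integral_Ioo]
  · calc _ ≤ ∫⁻ x in Set.Ioo 0 ε,
          (∫⁻ t in Set.Ioo 0 x, ‖g t‖ₑ) ^ 2 * ENNReal.ofReal (x ^ (-2 * b - 1)) := by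
          refine lintegral_mono fun x => ?_
          rw [hofReal]
          gcongr
          exact enorm_integral_le_lintegral_enorm _
      _ ≤ _ := lintegral_sq_lintegral_mul_rpow_le hb hgm.enorm
      _ = _ := by
          rw [one_div, div_eq_inv_mul, ENNReal.ofReal_mul (by positivity),
            ofReal_integral_eq_lintegral_ofReal hA (ae_restrict_of_forall_mem measurableSet_Ioo
              fun t ht => mul_nonneg (by positivity) (Real.rpow_nonneg ht.1.le _))]
          simp only [hofReal]
end
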